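/- There exists a [0,1]-valued value function v* satisfying (Hv*)(s_p)(b) = v*(s_p)(b) for all s_p ∈ V^N and all b ∈ Δ(V); any two bounded value functions that are both fixed by H in this pointwise sense on Δ(V) have sup-distance 0 (they agree at every s_p and every b ∈ Δ(V)); and recursive application of H converges to v*: for every [0,1]-valued value function v, the sup-distance ‖H^t v − v*‖ tends to 0 as t → ∞, where H^t denotes the t-fold iterate of H. -/

import Mathlib

open scoped Classical
open Finset

noncomputable section PEG

/-- The standard probability simplex over a finite set `V`. -/
def simplex (V : Type*) [Fintype V] : Set (V → ℝ) :=
  {b | (∀ v, 0 ≤ b v) ∧ ∑ v, b v = 1}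

/-- Evader one-step strategies: for each vertex `s`, a probability distribution over `V`
supported on `adj s`. -/
def EStrat {V : Type*} [Fintype V] (adj : V → Finset V) : Set (V → V → ℝ) :=
  {π | ∀ s, (∀ s', 0 ≤ π s s') ∧ (∑ s', π s s' = 1) ∧ (∀ s', s' ∉ adj s → π s s' = 0)}

/-- Successor positions of the pursuer: move every unit along an edge. -/
def AdjF {V : Type*} [Fintype V] {N : ℕ} (adj : V → Finset V) (s_p : Fin N → V) :
    Finset (Fin N → V) :=
  Finset.univ.filter (fun t => ∀ i, t i ∈ adj (s_p i))

/-- Pursuer one-step strategies at `s_p`: distributions over `Adj(s_p)`. -/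
def PStrat {V : Type*} [Fintype V] {N : ℕ} (adj : V → Finset V) (s_p : Fin N → V) :
    Set ((Fin N → V) → ℝ) :=
  {π | (∀ t, 0 ≤ π t) ∧ ∑ t ∈ AdjF adj s_p, π t = 1}

/-- Probability mass on vertices occupied by the pursuer. -/
def capt {V : Type*} [Fintype V] {N : ℕ} (s_p : Fin N → V) (b : V → ℝ) : ℝ :=
  ∑ s ∈ Finset.univ.filter (fun s => ∃ i, s_p i = s), b s

/-- Probability mass on vertices not occupied by the pursuer, `m(s_p, b)`. -/
def escMass {V : Type*} [Fintype V] {N : ℕ} (s_p : Fin N → V) (b : V → ℝ) : ℝ :=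
  ∑ s ∈ Finset.univ.filter (fun s => ¬ ∃ i, s_p i = s), b s

/-- The updated belief `b_{π_e}` after the evader plays one-step strategy `π_e`. -/
def bUpd {V : Type*} [Fintype V] {N : ℕ} (s_p : Fin N → V) (b : V → ℝ)
    (π_e : V → V → ℝ) : V → ℝ :=
  fun s' => (1 / escMass s_p b) *
    ∑ s ∈ Finset.univ.filter (fun s => ¬ ∃ i, s_p i = s), b s * π_e s s'

/-- `Q^v_{π_p}⟨s_p⟩(b)`: the value of playing the one-step strategy `π_p` in the first round
and continuing with value `v`. -/
def Qval {V : Type*} [Fintype V] {N : ℕ} (adj : V → Finset V) (γ : ℝ)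
    (v : (Fin N → V) → (V → ℝ) → ℝ) (s_p : Fin N → V) (π_p : (Fin N → V) → ℝ)
    (b : V → ℝ) : ℝ :=
  if escMass s_p b = 0 then 1
  else capt s_p b + γ * escMass s_p b *
    sInf {x | ∃ π_e ∈ EStrat adj, x = ∑ t ∈ AdjF adj s_p, π_p t * v t (bUpd s_p b π_e)}

/-- The dynamic-programming operator `H`. -/
def Hop {V : Type*} [Fintype V] {N : ℕ} (adj : V → Finset V) (γ : ℝ)
    (v : (Fin N → V) → (V → ℝ) → ℝ) : (Fin N → V) → (V → ℝ) → ℝ :=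
  fun s_p b => sSup {x | ∃ π_p ∈ PStrat adj s_p, x = Qval adj γ v s_p π_p b}

/-- The sup-distance `‖v − v̄‖` between value functions (over beliefs in the simplex). -/
def supDist {V : Type*} [Fintype V] {N : ℕ} (v w : (Fin N → V) → (V → ℝ) → ℝ) : ℝ :=
  sSup {x | ∃ s_p : Fin N → V, ∃ b ∈ simplex V, x = |v s_p b - w s_p b|}

/-- A value function is bounded. -/
def BoundedVF {V : Type*} [Fintype V] {N : ℕ} (v : (Fin N → V) → (V → ℝ) → ℝ) : Prop :=
  ∃ C : ℝ, ∀ s_p : Fin N → V, ∀ b ∈ simplex V, |v s_p b| ≤ C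

/-- A value function is `[0,1]`-valued. -/
def UnitValued {V : Type*} [Fintype V] {N : ℕ} (v : (Fin N → V) → (V → ℝ) → ℝ) : Prop :=
  ∀ s_p : Fin N → V, ∀ b ∈ simplex V, 0 ≤ v s_p b ∧ v s_p b ≤ 1

end PEG

section PEGLemmas

variable {V : Type*} [Fintype V] {N : ℕ}

theorem capt_add_escMass (s_p : Fin N → V) {b : V → ℝ} (hb : b ∈ simplex V) :
    capt s_p b + escMass s_p b = 1 := by
  rw [← hb.2]
  exact Finset.sum_filter_add_sum_filter_not _ _ _

theorem capt_nonneg (s_p : Fin N → V) {b : V → ℝ} (hb : b ∈ simplex V) : 0 ≤ capt s_p b :=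
  Finset.sum_nonneg fun s _ => hb.1 s

theorem escMass_nonneg (s_p : Fin N → V) {b : V → ℝ} (hb : b ∈ simplex V) :
    0 ≤ escMass s_p b :=
  Finset.sum_nonneg fun s _ => hb.1 s

theorem bUpd_mem_simplex {adj : V → Finset V} (s_p : Fin N → V) {b : V → ℝ}
    (hb : b ∈ simplex V) (hm : escMass s_p b ≠ 0) {π_e : V → V → ℝ} (hπ : π_e ∈ EStrat adj) :
    bUpd s_p b π_e ∈ simplex V := by
  refine ⟨fun s' => mul_nonneg (one_div_nonneg.2 (escMass_nonneg s_p hb))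
    (Finset.sum_nonneg fun s _ => mul_nonneg (hb.1 s) ((hπ s).1 s')), ?_⟩
  unfold bUpd
  rw [← Finset.mul_sum, Finset.sum_comm]
  simp_rw [← Finset.mul_sum, (hπ _).2.1, mul_one]
  exact one_div_mul_cancel hm

theorem EStrat_nonempty {adj : V → Finset V} (hadj : ∀ s, (adj s).Nonempty) :
    (EStrat adj).Nonempty := by
  choose f hf using hadj
  refine ⟨fun s => Pi.single (f s) (1 : ℝ), fun s => ⟨fun s' => ?_, by simp, fun s' hs' => ?_⟩⟩
  · simp only [Pi.single_apply]
    positivity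
  · exact Pi.single_eq_of_ne (by rintro rfl; exact hs' (hf s)) _

theorem PStrat_nonempty {adj : V → Finset V} (hadj : ∀ s, (adj s).Nonempty)
    (s_p : Fin N → V) : (PStrat adj s_p).Nonempty := by
  choose f hf using hadj
  have hmem : (fun i => f (s_p i)) ∈ AdjF adj s_p := by simp [AdjF, hf]
  refine ⟨Pi.single (fun i => f (s_p i)) (1 : ℝ), fun t => ?_, ?_⟩
  · rw [Pi.single_apply]
    positivity
  · simp [hmem]

/-- The worst-case continuation value appearing in `Qval`. -/
noncomputable def contVal (adj : V → Finset V) (v : (Fin N → V) → (V → ℝ) → ℝ) (s_p : Fin N → V)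
    (π_p : (Fin N → V) → ℝ) (b : V → ℝ) : ℝ :=
  sInf {x | ∃ π_e ∈ EStrat adj, x = ∑ t ∈ AdjF adj s_p, π_p t * v t (bUpd s_p b π_e)}

theorem Qval_of_ne {adj : V → Finset V} {γ : ℝ} {v : (Fin N → V) → (V → ℝ) → ℝ}
    {s_p : Fin N → V} {π_p : (Fin N → V) → ℝ} {b : V → ℝ} (hm : escMass s_p b ≠ 0) :
    Qval adj γ v s_p π_p b = capt s_p b + γ * escMass s_p b * contVal adj v s_p π_p b :=
  if_neg hm

theorem Qval_of_eq {adj : V → Finset V} {γ : ℝ} {v : (Fin N → V) → (V → ℝ) → ℝ}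
    {s_p : Fin N → V} {π_p : (Fin N → V) → ℝ} {b : V → ℝ} (hm : escMass s_p b = 0) :
    Qval adj γ v s_p π_p b = 1 :=
  if_pos hm

theorem sum_PStrat_mul_le_add {adj : V → Finset V} {s_p : Fin N → V}
    {π_p : (Fin N → V) → ℝ} (hπ : π_p ∈ PStrat adj s_p) {f g : (Fin N → V) → ℝ} {C : ℝ}
    (h : ∀ t, f t ≤ g t + C) :
    ∑ t ∈ AdjF adj s_p, π_p t * f t ≤ ∑ t ∈ AdjF adj s_p, π_p t * g t + C := by
  calc ∑ t ∈ AdjF adj s_p, π_p t * f t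
      ≤ ∑ t ∈ AdjF adj s_p, π_p t * (g t + C) :=
        Finset.sum_le_sum fun t _ => mul_le_mul_of_nonneg_left (h t) (hπ.1 t)
    _ = ∑ t ∈ AdjF adj s_p, π_p t * g t + C := by
        simp_rw [mul_add, Finset.sum_add_distrib, ← Finset.sum_mul, hπ.2, one_mul]

theorem contVal_le_add {adj : V → Finset V} (hadj : ∀ s, (adj s).Nonempty)
    {v w : (Fin N → V) → (V → ℝ) → ℝ} (hv : BoundedVF v) {C : ℝ}
    (h : ∀ t, ∀ b ∈ simplex V, v t b ≤ w t b + C) {s_p : Fin N → V}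
    {π_p : (Fin N → V) → ℝ} (hπ : π_p ∈ PStrat adj s_p) {b : V → ℝ} (hb : b ∈ simplex V)
    (hm : escMass s_p b ≠ 0) :
    contVal adj v s_p π_p b ≤ contVal adj w s_p π_p b + C := by
  obtain ⟨B, hB⟩ := hv
  rw [← sub_le_iff_le_add]
  obtain ⟨π₀, hπ₀⟩ := EStrat_nonempty hadj
  refine le_csInf ⟨_, π₀, hπ₀, rfl⟩ ?_
  rintro _ ⟨π_e, hπe, rfl⟩
  rw [sub_le_iff_le_add]
  refine le_trans (csInf_le ⟨-B, ?_⟩ ⟨π_e, hπe, rfl⟩)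
    (sum_PStrat_mul_le_add hπ fun t => h t _ (bUpd_mem_simplex s_p hb hm hπe))
  rintro _ ⟨π', hπ', rfl⟩
  have := sum_PStrat_mul_le_add hπ (f := fun _ => 0) (g := fun t => v t (bUpd s_p b π'))
    (C := B) fun t => by linarith [(abs_le.1 (hB t _ (bUpd_mem_simplex s_p hb hm hπ'))).1]
  simp only [mul_zero, Finset.sum_const_zero] at this
  linarith

theorem contVal_zero {adj : V → Finset V} (hadj : ∀ s, (adj s).Nonempty) (s_p : Fin N → V)
    (π_p : (Fin N → V) → ℝ) (b : V → ℝ) : contVal adj 0 s_p π_p b = 0 := by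
  obtain ⟨π₀, hπ₀⟩ := EStrat_nonempty hadj
  have : {x : ℝ | ∃ π_e ∈ EStrat adj, x = ∑ t ∈ AdjF adj s_p,
      π_p t * (0 : (Fin N → V) → (V → ℝ) → ℝ) t (bUpd s_p b π_e)} = {0} := by
    ext x
    simp only [Pi.zero_apply, mul_zero, Finset.sum_const_zero, Set.mem_ofPred_eq,
      Set.mem_singleton_iff]
    exact ⟨fun ⟨_, _, hx⟩ => hx, fun hx => ⟨π₀, hπ₀, hx⟩⟩
  rw [contVal, this, csInf_singleton]

theorem boundedVF_zero : BoundedVF (0 : (Fin N → V) → (V → ℝ) → ℝ) :=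
  ⟨0, fun _ _ _ => by simp⟩

theorem UnitValued.boundedVF {v : (Fin N → V) → (V → ℝ) → ℝ} (hv : UnitValued v) :
    BoundedVF v :=
  ⟨1, fun s b hb => abs_le.2 ⟨by linarith [(hv s b hb).1], (hv s b hb).2⟩⟩

theorem Qval_le_add {adj : V → Finset V} (hadj : ∀ s, (adj s).Nonempty) {γ : ℝ} (hγ : 0 ≤ γ)
    {v w : (Fin N → V) → (V → ℝ) → ℝ} (hv : BoundedVF v) {C : ℝ} (hC : 0 ≤ C)
    (h : ∀ t, ∀ b ∈ simplex V, v t b ≤ w t b + C) {s_p : Fin N → V}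
    {π_p : (Fin N → V) → ℝ} (hπ : π_p ∈ PStrat adj s_p) {b : V → ℝ} (hb : b ∈ simplex V) :
    Qval adj γ v s_p π_p b ≤ Qval adj γ w s_p π_p b + γ * C := by
  by_cases hm : escMass s_p b = 0
  · rw [Qval_of_eq hm, Qval_of_eq hm]
    linarith [mul_nonneg hγ hC]
  rw [Qval_of_ne hm, Qval_of_ne hm]
  have hm0 := escMass_nonneg s_p hb
  have hm1 : escMass s_p b ≤ 1 := by linarith [capt_add_escMass s_p hb, capt_nonneg s_p hb]
  have h₁ := mul_le_mul_of_nonneg_left (contVal_le_add hadj hv h hπ hb hm) (mul_nonneg hγ hm0)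
  have h₂ := mul_le_of_le_one_right (mul_nonneg hγ hC) hm1
  linarith

theorem Qval_zero_le_one {adj : V → Finset V} (hadj : ∀ s, (adj s).Nonempty) (γ : ℝ)
    (s_p : Fin N → V) (π_p : (Fin N → V) → ℝ) {b : V → ℝ} (hb : b ∈ simplex V) :
    Qval adj γ 0 s_p π_p b ≤ 1 := by
  by_cases hm : escMass s_p b = 0
  · rw [Qval_of_eq hm]
  · rw [Qval_of_ne hm, contVal_zero hadj]
    linarith [capt_add_escMass s_p hb, escMass_nonneg s_p hb]

theorem bddAbove_Qval {adj : V → Finset V} (hadj : ∀ s, (adj s).Nonempty) {γ : ℝ}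
    (hγ : 0 ≤ γ) {v : (Fin N → V) → (V → ℝ) → ℝ} (hv : BoundedVF v) (s_p : Fin N → V)
    {b : V → ℝ} (hb : b ∈ simplex V) :
    BddAbove {x | ∃ π_p ∈ PStrat adj s_p, x = Qval adj γ v s_p π_p b} := by
  obtain ⟨B, hB⟩ := hv
  refine ⟨1 + γ * B, ?_⟩
  rintro _ ⟨π, hπ, rfl⟩
  have hB0 : 0 ≤ B := (abs_nonneg _).trans (hB s_p b hb)
  have := Qval_le_add hadj hγ ⟨B, hB⟩ hB0 (w := 0)
    (fun t b hb => by simpa using (abs_le.1 (hB t b hb)).2) hπ hb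
  linarith [Qval_zero_le_one hadj γ s_p π hb]

theorem Hop_le_add {adj : V → Finset V} (hadj : ∀ s, (adj s).Nonempty) {γ : ℝ} (hγ : 0 ≤ γ)
    {v w : (Fin N → V) → (V → ℝ) → ℝ} (hv : BoundedVF v) (hw : BoundedVF w) {C : ℝ}
    (hC : 0 ≤ C) (h : ∀ t, ∀ b ∈ simplex V, v t b ≤ w t b + C) (s_p : Fin N → V)
    {b : V → ℝ} (hb : b ∈ simplex V) :
    Hop adj γ v s_p b ≤ Hop adj γ w s_p b + γ * C := by
  obtain ⟨π₀, hπ₀⟩ := PStrat_nonempty hadj s_p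
  refine csSup_le ⟨_, π₀, hπ₀, rfl⟩ ?_
  rintro _ ⟨π, hπ, rfl⟩
  exact (Qval_le_add hadj hγ hv hC h hπ hb).trans
    (add_le_add_left (le_csSup (bddAbove_Qval hadj hγ hw s_p hb) ⟨π, hπ, rfl⟩) _)

theorem abs_Hop_sub_le {adj : V → Finset V} (hadj : ∀ s, (adj s).Nonempty) {γ : ℝ}
    (hγ : 0 ≤ γ) {v w : (Fin N → V) → (V → ℝ) → ℝ} (hv : BoundedVF v) (hw : BoundedVF w)
    {C : ℝ} (h : ∀ t, ∀ b ∈ simplex V, |v t b - w t b| ≤ C) (s_p : Fin N → V)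
    {b : V → ℝ} (hb : b ∈ simplex V) :
    |Hop adj γ v s_p b - Hop adj γ w s_p b| ≤ γ * C := by
  have hC : 0 ≤ C := (abs_nonneg _).trans (h s_p b hb)
  have h₁ := Hop_le_add hadj hγ hv hw hC
    (fun t b hb => by linarith [(abs_le.1 (h t b hb)).2]) s_p hb
  have h₂ := Hop_le_add hadj hγ hw hv hC
    (fun t b hb => by linarith [(abs_le.1 (h t b hb)).1]) s_p hb
  exact abs_le.2 ⟨by linarith, by linarith⟩

theorem UnitValued.Hop {adj : V → Finset V} (hadj : ∀ s, (adj s).Nonempty) {γ : ℝ}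
    (hγ0 : 0 ≤ γ) (hγ1 : γ ≤ 1) {v : (Fin N → V) → (V → ℝ) → ℝ} (hv : UnitValued v) :
    UnitValued (Hop adj γ v) := by
  intro s_p b hb
  have hQ : ∀ π ∈ PStrat adj s_p, 0 ≤ Qval adj γ v s_p π b ∧ Qval adj γ v s_p π b ≤ 1 := by
    intro π hπ
    by_cases hm : escMass s_p b = 0
    · rw [Qval_of_eq hm]
      norm_num
    rw [Qval_of_ne hm]
    have hm0 := escMass_nonneg s_p hb
    have h₀ := contVal_le_add hadj boundedVF_zero (C := 0)
      (fun t b hb => by simpa using (hv t b hb).1) hπ hb hm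
    have h₁ := contVal_le_add hadj hv.boundedVF (w := 0) (C := 1)
      (fun t b hb => by simpa using (hv t b hb).2) hπ hb hm
    rw [contVal_zero hadj] at h₀ h₁
    rw [add_zero] at h₀
    rw [zero_add] at h₁
    have h₂ := mul_nonneg (mul_nonneg hγ0 hm0) h₀
    have h₃ := mul_le_of_le_one_right (mul_nonneg hγ0 hm0) h₁
    have h₄ := mul_le_of_le_one_left hm0 hγ1
    have h₅ := capt_add_escMass s_p hb
    exact ⟨add_nonneg (capt_nonneg s_p hb) h₂, by linarith⟩
  obtain ⟨π₀, hπ₀⟩ := PStrat_nonempty hadj s_p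
  constructor
  · exact (hQ π₀ hπ₀).1.trans
      (le_csSup (bddAbove_Qval hadj hγ0 hv.boundedVF s_p hb) ⟨π₀, hπ₀, rfl⟩)
  · refine csSup_le ⟨_, π₀, hπ₀, rfl⟩ ?_
    rintro _ ⟨π, hπ, rfl⟩
    exact (hQ π hπ).2

theorem UnitValued.iterate_Hop {adj : V → Finset V} (hadj : ∀ s, (adj s).Nonempty) {γ : ℝ}
    (hγ0 : 0 ≤ γ) (hγ1 : γ ≤ 1) {v : (Fin N → V) → (V → ℝ) → ℝ} (hv : UnitValued v) (t : ℕ) :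
    UnitValued ((_root_.Hop adj γ)^[t] v) := by
  induction t with
  | zero => exact hv
  | succ t ih =>
    rw [Function.iterate_succ_apply']
    exact ih.Hop hadj hγ0 hγ1

theorem UnitValued.abs_sub_le_one {v w : (Fin N → V) → (V → ℝ) → ℝ} (hv : UnitValued v)
    (hw : UnitValued w) (s_p : Fin N → V) {b : V → ℝ} (hb : b ∈ simplex V) :
    |v s_p b - w s_p b| ≤ 1 :=
  abs_le.2 ⟨by linarith [(hv s_p b hb).1, (hw s_p b hb).2],
    by linarith [(hv s_p b hb).2, (hw s_p b hb).1]⟩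

theorem abs_iterate_Hop_sub_le {adj : V → Finset V} (hadj : ∀ s, (adj s).Nonempty) {γ : ℝ}
    (hγ0 : 0 ≤ γ) (hγ1 : γ ≤ 1) {v w : (Fin N → V) → (V → ℝ) → ℝ} (hv : UnitValued v)
    (hw : UnitValued w) (t : ℕ) (s_p : Fin N → V) {b : V → ℝ} (hb : b ∈ simplex V) :
    |(Hop adj γ)^[t] v s_p b - (Hop adj γ)^[t] w s_p b| ≤ γ ^ t := by
  induction t generalizing s_p b with
  | zero => simpa using hv.abs_sub_le_one hw s_p hb
  | succ t ih =>
    rw [Function.iterate_succ_apply', Function.iterate_succ_apply', pow_succ']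
    exact abs_Hop_sub_le hadj hγ0 (hv.iterate_Hop hadj hγ0 hγ1 t).boundedVF
      (hw.iterate_Hop hadj hγ0 hγ1 t).boundedVF (fun s _ hb => ih s hb) s_p hb

theorem supDist_nonneg (v w : (Fin N → V) → (V → ℝ) → ℝ) : 0 ≤ supDist v w := by
  apply Real.sSup_nonneg
  rintro _ ⟨s, b, _, rfl⟩
  exact abs_nonneg _

theorem supDist_le {v w : (Fin N → V) → (V → ℝ) → ℝ} {C : ℝ} (hC : 0 ≤ C)
    (h : ∀ s, ∀ b ∈ simplex V, |v s b - w s b| ≤ C) : supDist v w ≤ C := by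
  refine Real.sSup_le ?_ hC
  rintro _ ⟨s, b, hb, rfl⟩
  exact h s b hb

theorem le_supDist {v w : (Fin N → V) → (V → ℝ) → ℝ} (hv : BoundedVF v) (hw : BoundedVF w)
    (s_p : Fin N → V) {b : V → ℝ} (hb : b ∈ simplex V) :
    |v s_p b - w s_p b| ≤ supDist v w := by
  obtain ⟨B, hB⟩ := hv
  obtain ⟨C, hC⟩ := hw
  refine le_csSup ⟨B + C, ?_⟩ ⟨s_p, b, hb, rfl⟩
  rintro _ ⟨s, b, hb, rfl⟩
  exact (abs_sub _ _).trans (add_le_add (hB s b hb) (hC s b hb))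

theorem exists_unitValued_fixed_point {adj : V → Finset V} (hadj : ∀ s, (adj s).Nonempty)
    {γ : ℝ} (hγ0 : 0 ≤ γ) (hγ1 : γ < 1) :
    ∃ u : (Fin N → V) → (V → ℝ) → ℝ, UnitValued u ∧
      ∀ s_p, ∀ b ∈ simplex V, Hop adj γ u s_p b = u s_p b := by
  have h0 : UnitValued (0 : (Fin N → V) → (V → ℝ) → ℝ) := fun _ _ _ => by simp
  have hunit := h0.iterate_Hop hadj hγ0 hγ1.le
  have hstep : ∀ s_p, ∀ b ∈ simplex V, ∀ t : ℕ,
      dist ((Hop adj γ)^[t] (0 : (Fin N → V) → (V → ℝ) → ℝ) s_p b)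
        ((Hop adj γ)^[t + 1] 0 s_p b) ≤ 1 * γ ^ t := by
    intro s_p b hb t
    rw [one_mul, Real.dist_eq, Function.iterate_succ_apply]
    exact abs_iterate_Hop_sub_le hadj hγ0 hγ1.le h0 (h0.Hop hadj hγ0 hγ1.le) t s_p hb
  have hlim : ∀ s_p b, ∃ x : ℝ, b ∈ simplex V → Filter.Tendsto
      (fun t => (Hop adj γ)^[t] (0 : (Fin N → V) → (V → ℝ) → ℝ) s_p b) Filter.atTop (nhds x) := by
    intro s_p b
    by_cases hb : b ∈ simplex V
    · obtain ⟨x, hx⟩ := cauchySeq_tendsto_of_complete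
        (cauchySeq_of_le_geometric γ 1 hγ1 (hstep s_p b hb))
      exact ⟨x, fun _ => hx⟩
    · exact ⟨0, fun h => absurd h hb⟩
  choose u hu using hlim
  have huu : UnitValued u := fun s_p b hb =>
    ⟨ge_of_tendsto' (hu s_p b hb) fun t => (hunit t s_p b hb).1,
      le_of_tendsto' (hu s_p b hb) fun t => (hunit t s_p b hb).2⟩
  refine ⟨u, huu, fun s_p b hb => ?_⟩
  have hbound : ∀ t : ℕ, |(Hop adj γ)^[t + 1] 0 s_p b - Hop adj γ u s_p b|
      ≤ γ * (1 * γ ^ t / (1 - γ)) := by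
    intro t
    rw [Function.iterate_succ_apply']
    exact abs_Hop_sub_le hadj hγ0 (hunit t).boundedVF huu.boundedVF
      (fun s b hb => dist_le_of_le_geometric_of_tendsto γ 1 hγ1 (hstep s b hb) (hu s b hb) t)
      s_p hb
  have hzero : Filter.Tendsto (fun t : ℕ => γ * (1 * γ ^ t / (1 - γ))) Filter.atTop (nhds 0) := by
    simpa using (((tendsto_pow_atTop_nhds_zero_of_lt_one hγ0 hγ1).const_mul 1).div_const
      (1 - γ)).const_mul γ
  refine tendsto_nhds_unique ?_ ((Filter.tendsto_add_atTop_iff_nat 1).2 (hu s_p b hb))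
  exact tendsto_iff_dist_tendsto_zero.2 (squeeze_zero (fun _ => dist_nonneg) hbound hzero)

end PEGLemmas

/-- **Theorem 7 of the paper.** There exists a `[0,1]`-valued value function
`v*` fixed by `H` pointwise on the simplex; any two bounded value functions fixed by `H` in
this pointwise sense have sup-distance `0` and agree at every `s_p` and every `b ∈ Δ(V)`;
and recursive application of `H` converges to `v*`: for every `[0,1]`-valued `v`,
`‖H^t v − v*‖ → 0` as `t → ∞`. -/
theorem H_unique_fixed_point_and_convergence {V : Type*} [Fintype V] [DecidableEq V]
    [Nonempty V] (adj : V → Finset V) (hadj : ∀ s, (adj s).Nonempty)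
    {N : ℕ} (hN : 0 < N) (γ : ℝ) (hγ0 : 0 ≤ γ) (hγ1 : γ < 1) :
    (∃ vstar : (Fin N → V) → (V → ℝ) → ℝ, UnitValued vstar ∧
      (∀ s_p : Fin N → V, ∀ b ∈ simplex V, Hop adj γ vstar s_p b = vstar s_p b) ∧
      (∀ v : (Fin N → V) → (V → ℝ) → ℝ, UnitValued v →
        Filter.Tendsto (fun t : ℕ => supDist ((Hop adj γ)^[t] v) vstar)
          Filter.atTop (nhds 0))) ∧
    (∀ v w : (Fin N → V) → (V → ℝ) → ℝ, BoundedVF v → BoundedVF w →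
      (∀ s_p : Fin N → V, ∀ b ∈ simplex V, Hop adj γ v s_p b = v s_p b) →
      (∀ s_p : Fin N → V, ∀ b ∈ simplex V, Hop adj γ w s_p b = w s_p b) →
      supDist v w = 0 ∧ ∀ s_p : Fin N → V, ∀ b ∈ simplex V, v s_p b = w s_p b) := by
  constructor
  · obtain ⟨u, hu, hfix⟩ := exists_unitValued_fixed_point (N := N) hadj hγ0 hγ1
    refine ⟨u, hu, hfix, fun v hv => ?_⟩
    refine squeeze_zero (fun _ => supDist_nonneg _ _) (fun t => ?_)
      (tendsto_pow_atTop_nhds_zero_of_lt_one hγ0 hγ1)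
    refine supDist_le (pow_nonneg hγ0 t) ?_
    induction t with
    | zero => exact fun s b hb => by simpa using hv.abs_sub_le_one hu s hb
    | succ t ih =>
      intro s b hb
      rw [Function.iterate_succ_apply', pow_succ', ← hfix s b hb]
      exact abs_Hop_sub_le hadj hγ0 (hv.iterate_Hop hadj hγ0 hγ1.le t).boundedVF hu.boundedVF
        ih s hb
  · intro v w hv hw hfv hfw
    have hle : supDist v w ≤ γ * supDist v w := by
      refine supDist_le (mul_nonneg hγ0 (supDist_nonneg v w)) fun s b hb => ?_
      rw [← hfv s b hb, ← hfw s b hb]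
      exact abs_Hop_sub_le hadj hγ0 hv hw (fun s _ hb => le_supDist hv hw s hb) s hb
    have hzero : supDist v w = 0 := by
      nlinarith [supDist_nonneg v w]
    refine ⟨hzero, fun s b hb => ?_⟩
    have := le_supDist hv hw s hb
    rw [hzero] at this
    exact sub_eq_zero.1 (abs_nonpos_iff.1 this)
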